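/- For any clustering C of a finite set X and any density parameter N_p, C is weakly separable for N_p if and only if every cluster of C is a maximal cluster (i.e., C is a dendrogram clustering: a partition of X into maximal clusters). -/

import Mathlib

variable {α : Type*}

/-- Sparsity ε_{N_p}(x): smallest ε ≥ 0 such that at least N_p points of X lie within
distance ε of x. -/
noncomputable def sparsity [MetricSpace α] (X : Finset α) (Np : ℕ) (x : α) : ℝ :=
  sInf {ε : ℝ | 0 ≤ ε ∧ Np ≤ (X.filter (fun y => dist x y ≤ ε)).card}

/-- x is ε-connected to y: there is a finite sequence of points of X from x to y,
each of sparsity at most ε, with consecutive distances at most ε. -/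
def EpsConn [MetricSpace α] (X : Finset α) (Np : ℕ) (ε : ℝ) (x y : α) : Prop :=
  x ∈ X ∧ sparsity X Np x ≤ ε ∧
    Relation.ReflTransGen (fun a b => b ∈ X ∧ sparsity X Np b ≤ ε ∧ dist a b ≤ ε) x y

/-- A set c is ε-connected if every pair of points of c is ε-connected. -/
def SetConn [MetricSpace α] (X : Finset α) (Np : ℕ) (ε : ℝ) (c : Finset α) : Prop :=
  ∀ x ∈ c, ∀ y ∈ c, EpsConn X Np ε x y

/-- ε*(c): the minimum ε such that c is ε-connected. -/
noncomputable def setSparsity [MetricSpace α] (X : Finset α) (Np : ℕ) (c : Finset α) : ℝ :=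
  sInf {ε : ℝ | SetConn X Np ε c}

/-- ε(x,y): the minimum ε such that x is ε-connected to y. -/
noncomputable def epsDist [MetricSpace α] (X : Finset α) (Np : ℕ) (x y : α) : ℝ :=
  sInf {ε : ℝ | EpsConn X Np ε x y}

/-- ε(x,c): min over y ∈ c of ε(x,y). -/
noncomputable def ptClusterDist [MetricSpace α] (X : Finset α) (Np : ℕ) (x : α)
    (c : Finset α) : ℝ :=
  sInf {e : ℝ | ∃ y ∈ c, e = epsDist X Np x y}

/-- ε(c,c'): min over x ∈ c, y ∈ c' of ε(x,y). -/
noncomputable def clusterDist [MetricSpace α] (X : Finset α) (Np : ℕ)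
    (c c' : Finset α) : ℝ :=
  sInf {e : ℝ | ∃ x ∈ c, ∃ y ∈ c', e = epsDist X Np x y}

/-- A clustering of X: a partition of X into nonempty clusters. -/
def IsClustering (X : Finset α) (C : Finset (Finset α)) : Prop :=
  (∀ c ∈ C, c.Nonempty) ∧ (∀ c ∈ C, ∀ c' ∈ C, c ≠ c' → Disjoint c c') ∧
    (∀ c ∈ C, c ⊆ X) ∧ (∀ x ∈ X, ∃ c ∈ C, x ∈ c)

/-- C is weakly separable: for each cluster c, ε*(c) < min over c' ≠ c of ε(c,c'). -/
def WeaklySeparable [MetricSpace α] (X : Finset α) (Np : ℕ) (C : Finset (Finset α)) : Prop :=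
  ∀ c ∈ C, ∀ c' ∈ C, c' ≠ c → setSparsity X Np c < clusterDist X Np c c'

/-- c is an ε-cluster: a (nonempty) maximal ε-connected subset of X. -/
def IsEpsCluster [MetricSpace α] (X : Finset α) (Np : ℕ) (ε : ℝ) (c : Finset α) : Prop :=
  c.Nonempty ∧ SetConn X Np ε c ∧ ∀ x ∈ X, (∃ y ∈ c, EpsConn X Np ε x y) → x ∈ c

/-- c is a maximal cluster: an ε-cluster for some ε ≥ 0. -/
def IsMaximalCluster [MetricSpace α] (X : Finset α) (Np : ℕ) (c : Finset α) : Prop :=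
  ∃ ε : ℝ, 0 ≤ ε ∧ IsEpsCluster X Np ε c

/-- x is a local maximum: every y ∈ X with d(x,y) ≤ ε_{N_p}(x) has sparsity ≥ that of x. -/
def IsLocalMaxPt [MetricSpace α] (X : Finset α) (Np : ℕ) (x : α) : Prop :=
  x ∈ X ∧ ∀ y ∈ X, dist x y ≤ sparsity X Np x → sparsity X Np x ≤ sparsity X Np y

/-- X_c*: the points of c of minimum sparsity within c. -/
noncomputable def minSparsityPts [MetricSpace α] (X : Finset α) (Np : ℕ)
    (c : Finset α) : Finset α :=
  c.filter (fun x => ∀ y ∈ c, sparsity X Np x ≤ sparsity X Np y)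

/-- Relative separability A(x,y) = ε(x,y) / ε_{N_p}(x). -/
noncomputable def relSep [MetricSpace α] (X : Finset α) (Np : ℕ) (x y : α) : ℝ :=
  epsDist X Np x y / sparsity X Np x

/-- A(x,c) = min over y ∈ c of A(x,y). -/
noncomputable def relSepCluster [MetricSpace α] (X : Finset α) (Np : ℕ) (x : α)
    (c : Finset α) : ℝ :=
  sInf {a : ℝ | ∃ y ∈ c, a = relSep X Np x y}

/-- A^ℓ(C): the minimum A such that for every local maximum x, every y in the cluster of x
with sparsity at most that of x satisfies A(x,y) ≤ A. -/
noncomputable def Aell [MetricSpace α] (X : Finset α) (Np : ℕ)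
    (C : Finset (Finset α)) : ℝ :=
  sInf {A : ℝ | ∀ x ∈ X, IsLocalMaxPt X Np x → ∀ c ∈ C, x ∈ c →
    ∀ y ∈ c, sparsity X Np y ≤ sparsity X Np x → relSep X Np x y ≤ A}

/-- C is LM-separable: A^ℓ(C) < min over distinct clusters c, c' and z ∈ X_c* of A(z,c'). -/
def LMSeparable [MetricSpace α] (X : Finset α) (Np : ℕ) (C : Finset (Finset α)) : Prop :=
  ∀ c ∈ C, ∀ c' ∈ C, c ≠ c' → ∀ z ∈ minSparsityPts X Np c,
    Aell X Np C < relSepCluster X Np z c'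

/-- min over x ∈ c of ε_{N_p}(x). -/
noncomputable def minSpars [MetricSpace α] (X : Finset α) (Np : ℕ) (c : Finset α) : ℝ :=
  sInf (sparsity X Np '' (c : Set α))

/-- max over x ∈ c of ε_{N_p}(x). -/
noncomputable def maxSpars [MetricSpace α] (X : Finset α) (Np : ℕ) (c : Finset α) : ℝ :=
  sSup (sparsity X Np '' (c : Set α))

/-- C is strongly separable: there is an A such that each cluster c is
(A · min sparsity of c)-connected and A · min sparsity of c < min over c' ≠ c of ε(c,c'). -/
def StronglySeparable [MetricSpace α] (X : Finset α) (Np : ℕ)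
    (C : Finset (Finset α)) : Prop :=
  ∃ A : ℝ, ∀ c ∈ C, SetConn X Np (A * minSpars X Np c) c ∧
    ∀ c' ∈ C, c' ≠ c → A * minSpars X Np c < clusterDist X Np c c'

/-- c*(x,ε): the set of points of X that are ε-connected to x. -/
def epsClusterAt [MetricSpace α] (X : Finset α) (Np : ℕ) (ε : ℝ) (x : α) : Set α :=
  {y | EpsConn X Np ε x y}

theorem sparsity_nonneg [MetricSpace α] (X : Finset α) (Np : ℕ) (x : α) :
    0 ≤ sparsity X Np x :=
  Real.sInf_nonneg fun _ h => h.1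

namespace EpsConn

variable [MetricSpace α] {X : Finset α} {Np : ℕ} {ε ε' : ℝ} {x y : α}

theorem nonneg (h : EpsConn X Np ε x y) : 0 ≤ ε :=
  (sparsity_nonneg X Np x).trans h.2.1

theorem mono (h : EpsConn X Np ε x y) (hε : ε ≤ ε') : EpsConn X Np ε' x y :=
  ⟨h.1, h.2.1.trans hε, Relation.ReflTransGen.mono
    (fun _ _ h => ⟨h.1, h.2.1.trans hε, h.2.2.trans hε⟩) _ _ h.2.2⟩

theorem symm (h : EpsConn X Np ε x y) : EpsConn X Np ε y x := by
  obtain ⟨hx, hs, h⟩ := h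
  induction h with
  | refl => exact ⟨hx, hs, .refl⟩
  | tail _ hbc ih =>
    exact ⟨hbc.1, hbc.2.1, .head ⟨ih.1, ih.2.1, by rw [dist_comm]; exact hbc.2.2⟩ ih.2.2⟩

/-- Connectivity only depends on which sparsities and distances are at most the parameter. -/
theorem of_imp (h : EpsConn X Np ε' x y)
    (hs : ∀ a ∈ X, sparsity X Np a ≤ ε' → sparsity X Np a ≤ ε)
    (hd : ∀ a ∈ X, ∀ b ∈ X, dist a b ≤ ε' → dist a b ≤ ε) : EpsConn X Np ε x y := by
  obtain ⟨hx, hsx, h⟩ := h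
  refine ⟨hx, hs x hx hsx, ?_⟩
  suffices H : y ∈ X ∧
      Relation.ReflTransGen (fun a b => b ∈ X ∧ sparsity X Np b ≤ ε ∧ dist a b ≤ ε) x y from H.2
  induction h with
  | refl => exact ⟨hx, .refl⟩
  | tail _ hbc ih =>
    exact ⟨hbc.1, ih.2.tail ⟨hbc.1, hs _ hbc.1 hbc.2.1, hd _ ih.1 _ hbc.1 hbc.2.2⟩⟩

end EpsConn

/-- Points connected at every larger parameter are connected. -/
theorem epsConn_of_forall_gt [MetricSpace α] {X : Finset α} {Np : ℕ} {ε : ℝ} {x y : α}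
    (h : ∀ ε' > ε, EpsConn X Np ε' x y) : EpsConn X Np ε x y := by
  have key : ∀ v : ℝ, ∀ᶠ ε' in nhdsWithin ε (Set.Ioi ε), v ≤ ε' → v ≤ ε := by
    intro v
    rcases le_or_gt v ε with hv | hv
    · exact Filter.Eventually.of_forall fun _ _ => hv
    · filter_upwards [mem_nhdsWithin_of_mem_nhds (Iio_mem_nhds hv)] with ε' hε' hle
      exact absurd hle (not_le.2 hε')
  have hs : ∀ᶠ ε' in nhdsWithin ε (Set.Ioi ε),
      ∀ a ∈ X, sparsity X Np a ≤ ε' → sparsity X Np a ≤ ε :=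
    (Filter.eventually_all_finset X).2 fun a _ => key _
  have hd : ∀ᶠ ε' in nhdsWithin ε (Set.Ioi ε),
      ∀ a ∈ X, ∀ b ∈ X, dist a b ≤ ε' → dist a b ≤ ε :=
    (Filter.eventually_all_finset X).2 fun a _ =>
      (Filter.eventually_all_finset X).2 fun b _ => key _
  obtain ⟨ε', hs, hd, hε'⟩ := (hs.and (hd.and self_mem_nhdsWithin)).exists
  exact (h ε' hε').of_imp hs hd

theorem exists_setConn [MetricSpace α] (X : Finset α) (Np : ℕ) :
    ∃ ε, SetConn X Np ε X := by
  obtain ⟨s, hs⟩ := (X.finite_toSet.image (sparsity X Np)).bddAbove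
  obtain ⟨r, hr⟩ := ((X ×ˢ X).finite_toSet.image fun p => dist p.1 p.2).bddAbove
  have hsX : ∀ a ∈ X, sparsity X Np a ≤ max s r := fun a ha =>
    (hs ⟨a, ha, rfl⟩).trans (le_max_left _ _)
  refine ⟨max s r, fun x hx y hy => ⟨hx, hsX x hx, .single ⟨hy, hsX y hy, ?_⟩⟩⟩
  exact (hr ⟨(x, y), by simp [hx, hy], rfl⟩).trans (le_max_right _ _)

theorem setConn_setSparsity [MetricSpace α] {X c : Finset α} (Np : ℕ)
    (hc : c ⊆ X) : SetConn X Np (setSparsity X Np c) c := by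
  intro x hx y hy
  refine epsConn_of_forall_gt fun ε' hε' => ?_
  obtain ⟨ε, hε⟩ := exists_setConn X Np
  obtain ⟨δ, hδ, hlt⟩ := exists_lt_of_csInf_lt
    (s := {ε : ℝ | SetConn X Np ε c}) ⟨ε, fun a ha b hb => hε a (hc ha) b (hc hb)⟩ hε'
  exact (hδ x hx y hy).mono hlt.le

theorem setSparsity_le [MetricSpace α] {X c : Finset α} {Np : ℕ} {ε : ℝ}
    (hc : c.Nonempty) (h : SetConn X Np ε c) : setSparsity X Np c ≤ ε := by
  obtain ⟨x, hx⟩ := hc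
  exact csInf_le ⟨0, fun _ hδ => (hδ x hx x hx).nonneg⟩ h

theorem epsDist_le_iff [MetricSpace α] {X : Finset α} {Np : ℕ} {ε : ℝ} {x y : α}
    (hx : x ∈ X) (hy : y ∈ X) : epsDist X Np x y ≤ ε ↔ EpsConn X Np ε x y := by
  refine ⟨fun h => epsConn_of_forall_gt fun ε' hε' => ?_,
    fun h => csInf_le ⟨0, fun _ hδ => EpsConn.nonneg hδ⟩ h⟩
  obtain ⟨δ₀, hδ₀⟩ := exists_setConn X Np
  obtain ⟨δ, hδ, hlt⟩ := exists_lt_of_csInf_lt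
    (s := {ε : ℝ | EpsConn X Np ε x y}) ⟨δ₀, hδ₀ x hx y hy⟩ (lt_of_le_of_lt h hε')
  exact EpsConn.mono hδ hlt.le

theorem lt_clusterDist_iff [MetricSpace α] {X c c' : Finset α} {Np : ℕ} {ε : ℝ}
    (hc : c.Nonempty) (hc' : c'.Nonempty) :
    ε < clusterDist X Np c c' ↔ ∀ x ∈ c, ∀ y ∈ c', ε < epsDist X Np x y := by
  have hfin : {e : ℝ | ∃ x ∈ c, ∃ y ∈ c', e = epsDist X Np x y}.Finite := by
    refine ((c ×ˢ c').finite_toSet.image fun p => epsDist X Np p.1 p.2).subset ?_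
    rintro _ ⟨x, hx, y, hy, rfl⟩
    exact ⟨(x, y), by simp [hx, hy], rfl⟩
  constructor
  · intro h x hx y hy
    exact h.trans_le (csInf_le hfin.bddBelow ⟨x, hx, y, hy, rfl⟩)
  · intro h
    obtain ⟨x₀, hx₀⟩ := hc
    obtain ⟨y₀, hy₀⟩ := hc'
    obtain ⟨x, hx, y, hy, he⟩ := Set.Nonempty.csInf_mem
      (s := {e : ℝ | ∃ x ∈ c, ∃ y ∈ c', e = epsDist X Np x y}) ⟨_, x₀, hx₀, y₀, hy₀, rfl⟩ hfin
    exact (h x hx y hy).trans_eq he.symm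

/-- C is weakly separable iff every cluster of C is a maximal cluster. -/
theorem stmt_0 {α : Type*} [MetricSpace α] (X : Finset α) (Np : ℕ)
    (hNp : 0 < Np) (hNpX : Np ≤ X.card)
    (C : Finset (Finset α)) (hC : IsClustering X C) :
    WeaklySeparable X Np C ↔ ∀ c ∈ C, IsMaximalCluster X Np c := by
  obtain ⟨hne, hdisj, hsub, hcov⟩ := hC
  constructor
  · intro hW c hc
    have hconn := setConn_setSparsity Np (hsub c hc)
    obtain ⟨z, hz⟩ := hne c hc
    refine ⟨setSparsity X Np c, (hconn z hz z hz).nonneg, ⟨z, hz⟩, hconn, ?_⟩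
    rintro x hx ⟨y, hy, hxy⟩
    obtain ⟨c', hc', hxc'⟩ := hcov x hx
    by_cases hcc : c' = c
    · exact hcc ▸ hxc'
    · have hlt := (lt_clusterDist_iff (hne c hc) (hne c' hc')).1 (hW c hc c' hc' hcc) y hy x hxc'
      exact absurd ((epsDist_le_iff (hsub c hc hy) hx).2 hxy.symm) (not_le.2 hlt)
  · intro hM c hc c' hc' hcc
    obtain ⟨ε, -, hcne, hconn, hmax⟩ := hM c hc
    refine (setSparsity_le hcne hconn).trans_lt
      ((lt_clusterDist_iff hcne (hne c' hc')).2 fun x hx y hy => ?_)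
    by_contra! hle
    have hyX := hsub c' hc' hy
    have hxy := (epsDist_le_iff (hsub c hc hx) hyX).1 hle
    exact Finset.disjoint_left.1 (hdisj c' hc' c hc hcc) hy (hmax y hyX ⟨x, hx, hxy.symm⟩)
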